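/- arXiv:2508.19901 — 10 statements merged into one kernel-verified Lean document; each statement's English description precedes it below -/
import Mathlib

section
/- Let n ≥ 2 and let H be the binary linear Hamming code of length 2^n − 1, namely H = {c : (F_2^n ∖ {0}) → F_2 | Σ_{v ∈ F_2^n ∖ {0}} c(v)·v = 0}. Suppose P ⊆ H is a Preparata-like code, i.e. |P| = 2^(2^n − 2n) and any two distinct elements of P have Hamming distance at least 5. Then H can be partitioned into additive translates of P: there exists a set T of 2^(n−1) vectors in F_2^(2^n − 1) such that the translates t + P := {t + p : p ∈ P}, for t ∈ T, are pairwise disjoint and their union equals H. -/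
/-- Codewords of length `2^n - 1`: functions from nonzero vectors of `F_2^n` to `F_2`. -/
abbrev Codeword (n : ℕ) := {v : Fin n → ZMod 2 // v ≠ 0} → ZMod 2

/-- The binary linear Hamming code of length `2^n - 1`. -/
def HammingCode (n : ℕ) : Set (Codeword n) :=
  {c | ∑ v : {v : Fin n → ZMod 2 // v ≠ 0}, c v • (v : Fin n → ZMod 2) = 0}

/-- The syndrome map, whose kernel is the Hamming code. -/
def syndrome (n : ℕ) : Codeword n →ₗ[ZMod 2] (Fin n → ZMod 2) :=
  Fintype.linearCombination (ZMod 2) Subtype.val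

theorem mem_hammingCode_iff {n : ℕ} {c : Codeword n} :
    c ∈ HammingCode n ↔ syndrome n c = 0 := Iff.rfl

/-- The codeword whose support is `{w}`, or `∅` when `w = 0`. -/
def pointWord {n : ℕ} (w : Fin n → ZMod 2) : Codeword n :=
  fun v => if v.1 = w then 1 else 0

theorem syndrome_pointWord {n : ℕ} (w : Fin n → ZMod 2) : syndrome n (pointWord w) = w := by
  rw [syndrome, Fintype.linearCombination_apply]
  by_cases hw : w = 0
  · refine (Finset.sum_eq_zero fun v _ => ?_).trans hw.symm
    simp [pointWord, hw, v.2]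
  · rw [Finset.sum_eq_single ⟨w, hw⟩]
    · simp [pointWord]
    · intro v _ hv
      have : v.1 ≠ w := fun h => hv (Subtype.ext h)
      simp [pointWord, this]
    · simp

theorem ncard_hammingCode (n : ℕ) : (HammingCode n).ncard = 2 ^ (2 ^ n - 1 - n) := by
  have hsurj : LinearMap.range (syndrome n) = ⊤ :=
    LinearMap.range_eq_top.2 fun w => ⟨pointWord w, syndrome_pointWord w⟩
  have hrank := (syndrome n).finrank_range_add_finrank_ker
  rw [hsurj, finrank_top, Module.finrank_fin_fun, Module.finrank_fintype_fun_eq_card,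
    Fintype.card_subtype_compl, Fintype.card_subtype_eq] at hrank
  simp only [Fintype.card_pi, ZMod.card, Finset.prod_const, Finset.card_univ,
    Fintype.card_fin] at hrank
  have hker : HammingCode n = (LinearMap.ker (syndrome n) : Set (Codeword n)) := rfl
  rw [hker, ← Nat.card_coe_set_eq]
  refine (Module.natCard_eq_pow_finrank (K := ZMod 2) (V := LinearMap.ker (syndrome n))).trans ?_
  rw [Nat.card_zmod]
  congr 1
  omega

/-- For `u ≠ 0`, the weight-three Hamming codeword supported on the line through `(1, 0)` and
`(0, u)`; for `u = 0`, the zero word. -/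
def lineWord {m : ℕ} (u : Fin m → ZMod 2) : Codeword (m + 1) :=
  pointWord (Fin.cons 1 0) + (pointWord (Fin.cons 0 u) + pointWord (Fin.cons 1 u))

theorem lineWord_mem_hammingCode {m : ℕ} (u : Fin m → ZMod 2) :
    lineWord u ∈ HammingCode (m + 1) := by
  rw [mem_hammingCode_iff, lineWord, map_add, map_add, syndrome_pointWord, syndrome_pointWord,
    syndrome_pointWord]
  funext i
  refine Fin.cases ?_ (fun j => ?_) i
  · simpa using CharTwo.add_self_eq_zero (1 : ZMod 2)
  · simpa using CharTwo.add_self_eq_zero (u j)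

theorem lineWord_apply_cons_one {m : ℕ} (u w : Fin m → ZMod 2) (hw : w ≠ 0)
    (h : (Fin.cons 1 w : Fin (m + 1) → ZMod 2) ≠ 0) :
    lineWord u ⟨Fin.cons 1 w, h⟩ = if w = u then 1 else 0 := by
  simp [lineWord, pointWord, Fin.cons_inj, hw]

theorem lineWord_injective {m : ℕ} : Function.Injective (lineWord (m := m)) := by
  have key : ∀ u w : Fin m → ZMod 2, w ≠ 0 → lineWord u = lineWord w → u = w := by
    intro u w hw h
    have hne : (Fin.cons 1 w : Fin (m + 1) → ZMod 2) ≠ 0 := fun h0 => by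
      simpa using congrFun h0 0
    have := congrFun h ⟨Fin.cons 1 w, hne⟩
    rw [lineWord_apply_cons_one u w hw, lineWord_apply_cons_one w w hw] at this
    by_contra huw
    simp [Ne.symm huw] at this
  intro u w h
  by_cases hw : w = 0
  · by_cases hu : u = 0
    · rw [hu, hw]
    · exact (key w u hu h.symm).symm
  · exact key u w hw h

theorem hammingNorm_pointWord_le {n : ℕ} (w : Fin n → ZMod 2) :
    hammingNorm (pointWord w) ≤ 1 := by
  refine Finset.card_le_one.2 fun a ha b hb => Subtype.ext ?_
  simp only [pointWord, Finset.mem_filter, ne_eq, ite_eq_right_iff, one_ne_zero, imp_false,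
    not_not] at ha hb
  exact ha.2.trans hb.2.symm

theorem hammingNorm_add_le {ι : Type*} [Fintype ι] {β : ι → Type*} [∀ i, AddGroup (β i)]
    [∀ i, DecidableEq (β i)] (x y : ∀ i, β i) :
    hammingNorm (x + y) ≤ hammingNorm x + hammingNorm y := by
  have h := hammingDist_triangle (-x) 0 y
  rw [hammingDist_zero_right, hammingDist_zero_left, hammingDist_eq_hammingNorm, neg_neg] at h
  rwa [show hammingNorm (-x) = hammingNorm x by simp [hammingNorm]] at h

theorem hammingDist_lineWord_le {m : ℕ} (u w : Fin m → ZMod 2) :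
    hammingDist (lineWord u) (lineWord w) ≤ 4 := by
  have hline : -lineWord u + lineWord w =
      (pointWord (Fin.cons 0 u) + pointWord (Fin.cons 1 u)) +
        (pointWord (Fin.cons 0 w) + pointWord (Fin.cons 1 w)) := by
    rw [neg_add_eq_sub, lineWord, lineWord, add_sub_add_left_eq_sub, sub_eq_neg_add]
    congr 1
    funext v
    exact ZMod.neg_eq_self_mod_two _
  rw [hammingDist_eq_hammingNorm, hline]
  have h₁ := hammingNorm_pointWord_le (Fin.cons 0 u : Fin (m + 1) → ZMod 2)
  have h₂ := hammingNorm_pointWord_le (Fin.cons 1 u : Fin (m + 1) → ZMod 2)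
  have h₃ := hammingNorm_pointWord_le (Fin.cons 0 w : Fin (m + 1) → ZMod 2)
  have h₄ := hammingNorm_pointWord_le (Fin.cons 1 w : Fin (m + 1) → ZMod 2)
  refine (hammingNorm_add_le _ _).trans ?_
  have h₅ := hammingNorm_add_le (pointWord (Fin.cons 0 u : Fin (m + 1) → ZMod 2))
    (pointWord (Fin.cons 1 u))
  have h₆ := hammingNorm_add_le (pointWord (Fin.cons 0 w : Fin (m + 1) → ZMod 2))
    (pointWord (Fin.cons 1 w))
  omega

/-- Translates of a code by distinct vectors closer than its minimum distance are disjoint. -/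
theorem disjoint_translates {ι : Type*} [Fintype ι] {β : ι → Type*} [∀ i, AddCommGroup (β i)]
    [∀ i, DecidableEq (β i)] {P : Set (∀ i, β i)} {d : ℕ}
    (hP : ∀ p ∈ P, ∀ q ∈ P, p ≠ q → d ≤ hammingDist p q) {s t : ∀ i, β i} (hst : s ≠ t)
    (hd : hammingDist s t < d) :
    Disjoint ((fun p => s + p) '' P) ((fun p => t + p) '' P) := by
  rw [Set.disjoint_left]
  rintro _ ⟨p, hp, rfl⟩ ⟨q, hq, h⟩
  have hsub : -q + p = -s + t := by
    rw [neg_add_eq_sub, neg_add_eq_sub, sub_eq_sub_iff_add_eq_add, add_comm p s]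
    exact h.symm
  have hqp : q ≠ p := fun h0 => hst (neg_add_eq_zero.1 (by rw [← hsub, h0, neg_add_cancel]))
  have hle := hP q hq p hp hqp
  rw [hammingDist_eq_hammingNorm, hsub, ← hammingDist_eq_hammingNorm] at hle
  omega

theorem stmt_0 (n : ℕ) (hn : 2 ≤ n) (P : Finset (Codeword n))
    (hPH : ↑P ⊆ HammingCode n)
    (hPcard : P.card = 2 ^ (2 ^ n - 2 * n))
    (hPdist : ∀ p ∈ P, ∀ q ∈ P, p ≠ q → 5 ≤ hammingDist p q) :
    ∃ T : Finset (Codeword n),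
      T.card = 2 ^ (n - 1) ∧
      (∀ t₁ ∈ T, ∀ t₂ ∈ T, t₁ ≠ t₂ →
        Disjoint ((fun p => t₁ + p) '' ↑P) ((fun p => t₂ + p) '' ↑P)) ∧
      (⋃ t ∈ T, (fun p => t + p) '' (↑P : Set (Codeword n))) = HammingCode n := by
  obtain ⟨m, rfl⟩ : ∃ m, n = m + 1 := ⟨n - 1, by omega⟩
  have hTcard : (Finset.univ.image (lineWord (m := m))).card = 2 ^ (m + 1 - 1) := by
    rw [Finset.card_image_of_injective _ lineWord_injective]
    simp [ZMod.card]
  have hdisj : ∀ t₁ ∈ Finset.univ.image (lineWord (m := m)),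
      ∀ t₂ ∈ Finset.univ.image (lineWord (m := m)), t₁ ≠ t₂ →
        Disjoint ((fun p => t₁ + p) '' (P : Set (Codeword (m + 1))))
          ((fun p => t₂ + p) '' (P : Set (Codeword (m + 1)))) := by
    intro t₁ h₁ t₂ h₂ hne
    obtain ⟨u, -, rfl⟩ := Finset.mem_image.1 h₁
    obtain ⟨w, -, rfl⟩ := Finset.mem_image.1 h₂
    exact disjoint_translates hPdist hne (Nat.lt_succ_of_le (hammingDist_lineWord_le u w))
  refine ⟨_, hTcard, hdisj, Set.eq_of_subset_of_ncard_le ?_ ?_ (Set.toFinite _)⟩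
  · refine Set.iUnion₂_subset fun t ht => ?_
    obtain ⟨u, -, rfl⟩ := Finset.mem_image.1 ht
    rintro _ ⟨p, hp, rfl⟩
    have hp' := mem_hammingCode_iff.1 (hPH hp)
    have hu := mem_hammingCode_iff.1 (lineWord_mem_hammingCode u)
    exact mem_hammingCode_iff.2 (by rw [map_add, hu, hp', add_zero])
  · have hunion : (⋃ t ∈ Finset.univ.image (lineWord (m := m)),
        (fun p => t + p) '' (P : Set (Codeword (m + 1)))) =
        ((Finset.univ.image (lineWord (m := m))).biUnion fun t => P.image (fun p => t + p) :
          Finset (Codeword (m + 1))) := by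
      simp only [Finset.coe_biUnion, Finset.coe_image]
      ext x
      simp
    rw [hunion, Set.ncard_coe_finset, Finset.card_biUnion]
    · simp only [Finset.card_image_of_injective _ (add_right_injective _), Finset.sum_const,
        smul_eq_mul]
      rw [hTcard, hPcard, ncard_hammingCode, ← pow_add]
      have : m + 1 ≤ 2 ^ m := Nat.lt_two_pow_self
      exact Nat.pow_le_pow_right two_pos (by rw [pow_succ]; omega)
    · intro t₁ h₁ t₂ h₂ hne
      rw [Function.onFun, ← Finset.disjoint_coe, Finset.coe_image, Finset.coe_image]
      exact hdisj t₁ h₁ t₂ h₂ hne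
end

section
/- Let f be a crooked function over K = F_{2^n}. Then for all (x, x₁), (y, y₁) ∈ K × F_2 we have c_f((x,x₁),(y,y₁)) = 0 if and only if (x,x₁) = (0,0) or (y,y₁) = (0,0) or (x,x₁) = (y,y₁). -/
/-- A crooked function on `K = F_{2^n}`. -/
def Crooked (n : ℕ) (f : GaloisField 2 n → GaloisField 2 n) : Prop :=
  f 0 = 0 ∧
  (∀ x y z : GaloisField 2 n, x ≠ y → y ≠ z → x ≠ z →
    f x + f y + f z + f (x + y + z) ≠ 0) ∧
  (∀ a : GaloisField 2 n, a ≠ 0 → ∀ x y z : GaloisField 2 n,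
    f x + f y + f z + f (x + a) + f (y + a) + f (z + a) ≠ 0)

/-- The coloring function `c_f` on `(K × F_2) × (K × F_2)`. -/
noncomputable def cf (n : ℕ) (f : GaloisField 2 n → GaloisField 2 n)
    (p q : GaloisField 2 n × ZMod 2) : GaloisField 2 n :=
  f (p.1 + q.1) + f p.1 + f q.1 + f (p.2 • q.1 + q.2 • p.1)

/-- The symmetric bivariate function `B_f(x,y) = f(x+y) + f(x) + f(y)`. -/
noncomputable def Bf (n : ℕ) (f : GaloisField 2 n → GaloisField 2 n)
    (x y : GaloisField 2 n) : GaloisField 2 n :=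
  f (x + y) + f x + f y

/-- `f` is quadratic: `B_f` is additive in each argument. -/
def IsQuadratic (n : ℕ) (f : GaloisField 2 n → GaloisField 2 n) : Prop :=
  (∀ x y z : GaloisField 2 n, Bf n f (x + y) z = Bf n f x z + Bf n f y z) ∧
  (∀ x y z : GaloisField 2 n, Bf n f x (y + z) = Bf n f x y + Bf n f x z)

/-- `f` is almost perfect nonlinear. -/
def IsAPN (n : ℕ) (f : GaloisField 2 n → GaloisField 2 n) : Prop :=
  ∀ a : GaloisField 2 n, a ≠ 0 → ∀ b : GaloisField 2 n,
    {x : GaloisField 2 n | f (x + a) + f x = b}.ncard = 0 ∨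
    {x : GaloisField 2 n | f (x + a) + f x = b}.ncard = 2

theorem Crooked.injective {n : ℕ} {f : GaloisField 2 n → GaloisField 2 n}
    (hf : Crooked n f) : Function.Injective f := by
  intro x y hxy
  by_contra hne
  refine hf.2.2 (x + y) (fun h => hne (CharTwo.add_eq_zero.1 h)) x x x ?_
  have hxa : x + (x + y) = y := CharTwo.add_cancel_left x y
  rw [hxa, hxy, CharTwo.add_self_eq_zero, zero_add, CharTwo.add_self_eq_zero, zero_add,
    CharTwo.add_self_eq_zero]

theorem Crooked.Bf_eq_zero_iff {n : ℕ} {f : GaloisField 2 n → GaloisField 2 n}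
    (hf : Crooked n f) (x y : GaloisField 2 n) :
    Bf n f x y = 0 ↔ x = 0 ∨ y = 0 ∨ x = y := by
  constructor
  · intro h
    by_contra! hne
    refine hf.2.1 x y 0 hne.2.2 hne.2.1 hne.1 ?_
    rw [hf.1, add_zero, add_zero, ← h, Bf]
    ring
  · rintro (rfl | rfl | rfl) <;> simp [Bf, hf.1, CharTwo.add_self_eq_zero]

theorem stmt_5 (n : ℕ) (hn : 0 < n) (f : GaloisField 2 n → GaloisField 2 n)
    (hf : Crooked n f) (x y : GaloisField 2 n) (x₁ y₁ : ZMod 2) :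
    cf n f (x, x₁) (y, y₁) = 0 ↔
      (x, x₁) = ((0 : GaloisField 2 n), (0 : ZMod 2)) ∨
      (y, y₁) = ((0 : GaloisField 2 n), (0 : ZMod 2)) ∨
      (x, x₁) = (y, y₁) := by
  have bit : ∀ a : ZMod 2, a = 0 ∨ a = 1 := by decide
  rcases bit x₁ with rfl | rfl <;> rcases bit y₁ with rfl | rfl
  · simpa [cf, Bf, hf.1] using hf.Bf_eq_zero_iff x y
  · have h : cf n f (x, 0) (y, 1) = f (x + y) + f y := by
      simp only [cf, zero_smul, one_smul, zero_add]
      linear_combination CharTwo.add_self_eq_zero (f x)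
    rw [h, CharTwo.add_eq_zero, hf.injective.eq_iff]
    simp
  · have h : cf n f (x, 1) (y, 0) = f (x + y) + f x := by
      simp only [cf, zero_smul, one_smul, add_zero]
      linear_combination CharTwo.add_self_eq_zero (f y)
    rw [h, CharTwo.add_eq_zero, hf.injective.eq_iff]
    simp
  · have h : cf n f (x, 1) (y, 1) = f x + f y := by
      simp only [cf, one_smul, add_comm y x]
      linear_combination CharTwo.add_self_eq_zero (f (x + y))
    rw [h, CharTwo.add_eq_zero, hf.injective.eq_iff]
    simp
end

section
/- Let f be a crooked function over K = F_{2^n}. Then c_f is constant on lines of PG(n, 2): for any distinct nonzero p, q ∈ K × F_2 one has c_f(p, q) = c_f(p, p + q) = c_f(q, p + q). Hence c_f induces a coloring of the lines of PG(n, 2) by elements of K ∖ {0}. -/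
/-- A crooked function is injective, in additive form. -/
theorem Crooked.add_ne_zero {n : ℕ} {f : GaloisField 2 n → GaloisField 2 n}
    (hf : Crooked n f) {x y : GaloisField 2 n} (hxy : x ≠ y) : f x + f y ≠ 0 := by
  intro h
  have two : (2 : GaloisField 2 n) = 0 := CharTwo.two_eq_zero
  have hne : x + y ≠ 0 := fun h' => hxy (CharTwo.add_eq_zero.mp h')
  apply hf.2.2 (x + y) hne x x x
  have hy : x + (x + y) = y := by linear_combination x * two
  rw [hy]
  linear_combination 3 * h

theorem stmt_6 (n : ℕ) (hn : 0 < n) (f : GaloisField 2 n → GaloisField 2 n)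
    (hf : Crooked n f) (p q : GaloisField 2 n × ZMod 2)
    (hp : p ≠ 0) (hq : q ≠ 0) (hpq : p ≠ q) :
    cf n f p q = cf n f p (p + q) ∧
    cf n f p q = cf n f q (p + q) ∧
    cf n f p q ≠ 0 := by
  have two : (2 : GaloisField 2 n) = 0 := CharTwo.two_eq_zero
  have add_self : ∀ x : GaloisField 2 n, x + x = 0 := CharTwo.add_self_eq_zero
  have f_zero : f 0 = 0 := hf.1
  obtain ⟨x, a⟩ := p
  obtain ⟨y, b⟩ := q
  have cancel_left : x + (x + y) = y := by linear_combination x * two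
  have cancel_right : y + (x + y) = x := by linear_combination y * two
  have cancel_left' : x + y + x = y := by linear_combination x * two
  have cancel_right' : x + y + y = x := by linear_combination y * two
  have add_comm_xy : y + x = x + y := add_comm y x
  have one_add_one : (1 : ZMod 2) + 1 = 0 := by decide
  have zmod_cases : ∀ c : ZMod 2, c = 0 ∨ c = 1 := by decide
  rcases zmod_cases a with rfl | rfl <;> rcases zmod_cases b with rfl | rfl <;>
    simp only [cf, Prod.mk_add_mk, zero_smul, one_smul, add_zero, zero_add, one_add_one,
      cancel_left, cancel_right, cancel_left', cancel_right', add_self, add_comm_xy, f_zero]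
  · have hx : x ≠ 0 := by rintro rfl; exact hp rfl
    have hy : y ≠ 0 := by rintro rfl; exact hq rfl
    have hxy : x ≠ y := by rintro rfl; exact hpq rfl
    refine ⟨by ring, by ring, fun h => hf.2.1 x y 0 hxy hy hx ?_⟩
    simp only [f_zero, add_zero]
    linear_combination h
  · have hx : x ≠ 0 := by rintro rfl; exact hp rfl
    refine ⟨by ring, by ring, fun h => hf.add_ne_zero (x := x + y) (y := y) (by simpa) ?_⟩
    linear_combination h - f x * two
  · have hy : y ≠ 0 := by rintro rfl; exact hq rfl
    refine ⟨by ring, by ring, fun h => hf.add_ne_zero (x := x + y) (y := x) (by simpa) ?_⟩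
    linear_combination h - f y * two
  · have hxy : x ≠ y := by rintro rfl; exact hpq rfl
    refine ⟨by ring, by ring, fun h => hf.add_ne_zero hxy ?_⟩
    linear_combination h - f (x + y) * two
end

section
/- Let f be a crooked function over K = F_{2^n}. Then distinct intersecting lines of PG(n, 2) receive distinct colors under c_f: for every nonzero p ∈ K × F_2 and every q, r ∈ (K × F_2) ∖ {0, p} with r ∉ {q, p + q}, one has c_f(p, q) ≠ c_f(p, r). Moreover, for every nonzero p ∈ K × F_2, the set {c_f(p, q) : q ∈ (K × F_2) ∖ {0, p}} equals K ∖ {0}; consequently the color classes of c_f constitute 2^n − 1 pairwise disjoint spreads forming a line-parallelism of PG(n, 2). -/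
theorem add_self_point (n : ℕ) (p : GaloisField 2 n × ZMod 2) : p + p = 0 :=
  Prod.ext (CharTwo.add_self_eq_zero _) (CharTwo.add_self_eq_zero _)

theorem add_add_cancel_point (n : ℕ) (p q : GaloisField 2 n × ZMod 2) : p + (p + q) = q := by
  rw [← add_assoc, add_self_point, zero_add]

theorem ZMod.two_eq_zero_or_one (a : ZMod 2) : a = 0 ∨ a = 1 := by
  revert a; decide

theorem cf_comm (n : ℕ) (f : GaloisField 2 n → GaloisField 2 n)
    (p q : GaloisField 2 n × ZMod 2) : cf n f p q = cf n f q p := by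
  unfold cf
  rw [add_comm p.1 q.1, add_comm (p.2 • q.1)]
  ring

/-- The color is constant along the line through `p` and `q`. -/
theorem cf_add_right (n : ℕ) (f : GaloisField 2 n → GaloisField 2 n)
    (p q : GaloisField 2 n × ZMod 2) : cf n f p (p + q) = cf n f p q := by
  have h1 : p.1 + (p + q).1 = q.1 := congrArg Prod.fst (add_add_cancel_point n p q)
  have h2 : p.2 • (p + q).1 + (p + q).2 • p.1 = p.2 • q.1 + q.2 • p.1 := by
    rw [Prod.fst_add, Prod.snd_add, smul_add, add_smul]
    linear_combination CharTwo.add_self_eq_zero (p.2 • p.1)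
  unfold cf
  rw [h1, h2, Prod.fst_add]
  ring

theorem cf_zero_right {n : ℕ} {f : GaloisField 2 n → GaloisField 2 n} (hf : Crooked n f)
    (p : GaloisField 2 n × ZMod 2) : cf n f p 0 = 0 := by
  simp [cf, hf.1, CharTwo.add_self_eq_zero]

theorem cf_self {n : ℕ} {f : GaloisField 2 n → GaloisField 2 n} (hf : Crooked n f)
    (p : GaloisField 2 n × ZMod 2) : cf n f p p = 0 := by
  rw [← cf_add_right, add_self_point, cf_zero_right hf]

/-- Two derivatives in direction `x` agree only at points that differ by `0` or `x`. -/
theorem Crooked.eq_or_eq_add {n : ℕ} {f : GaloisField 2 n → GaloisField 2 n}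
    (hf : Crooked n f) {x y z : GaloisField 2 n} (hx : x ≠ 0)
    (h : f (x + y) + f y = f (x + z) + f z) : z = y ∨ z = x + y := by
  by_contra! hzy
  refine hf.2.1 (x + y) y z (by simpa using hx) hzy.1.symm hzy.2.symm ?_
  rw [show x + y + y + z = x + z by
    linear_combination CharTwo.add_self_eq_zero y]
  linear_combination h + CharTwo.add_self_eq_zero (f (x + z)) +
    CharTwo.add_self_eq_zero (f z)

theorem Crooked.derivative_ne {n : ℕ} {f : GaloisField 2 n → GaloisField 2 n}
    (hf : Crooked n f) {x : GaloisField 2 n} (hx : x ≠ 0) (y z : GaloisField 2 n) :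
    f (x + y) + f y ≠ f (x + z) + f x + f z := by
  intro h
  refine hf.2.2 x hx y z 0 ?_
  rw [add_comm y x, add_comm z x, zero_add, hf.1]
  linear_combination h + CharTwo.add_self_eq_zero (f (x + z)) +
    CharTwo.add_self_eq_zero (f z) + CharTwo.add_self_eq_zero (f x)

/-- Points joined to `p` by lines of the same color lie on the same line through `p`. -/
theorem Crooked.eq_or_eq_add_of_cf_eq {n : ℕ} {f : GaloisField 2 n → GaloisField 2 n}
    (hf : Crooked n f) {p : GaloisField 2 n × ZMod 2} (hp : p ≠ 0)
    {q r : GaloisField 2 n × ZMod 2} (h : cf n f p q = cf n f p r) :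
    r = q ∨ r = p + q := by
  obtain ⟨x, a⟩ := p
  rcases ZMod.two_eq_zero_or_one a with rfl | rfl
  · have hx : x ≠ 0 := fun h0 => hp (Prod.ext h0 rfl)
    obtain ⟨y, b⟩ := q
    obtain ⟨z, c⟩ := r
    have e0 (w : GaloisField 2 n) : cf n f (x, 0) (w, 0) = f (x + w) + f x + f w := by
      simp [cf, hf.1]
    have e1 (w : GaloisField 2 n) : cf n f (x, 0) (w, 1) = f (x + w) + f w := by
      simp only [cf, zero_smul, one_smul, zero_add]
      linear_combination CharTwo.add_self_eq_zero (f x)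
    rcases ZMod.two_eq_zero_or_one b with rfl | rfl <;>
      rcases ZMod.two_eq_zero_or_one c with rfl | rfl <;>
      simp only [e0, e1] at h
    · simpa using hf.eq_or_eq_add hx
        (show f (x + y) + f y = f (x + z) + f z by linear_combination h)
    · exact absurd h.symm (hf.derivative_ne hx z y)
    · exact absurd h (hf.derivative_ne hx y z)
    · simpa using hf.eq_or_eq_add hx h
  · have hrep (q : GaloisField 2 n × ZMod 2) : ∃ y, ((y, 0) = q ∨ (y, 0) = (x, 1) + q) ∧
        cf n f (x, 1) q = f (x + y) + f x := by
      have e0 (w : GaloisField 2 n) : cf n f (x, 1) (w, 0) = f (x + w) + f x := by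
        simp only [cf, zero_smul, one_smul, add_zero]
        linear_combination CharTwo.add_self_eq_zero (f w)
      obtain ⟨y, b⟩ := q
      rcases ZMod.two_eq_zero_or_one b with rfl | rfl
      · exact ⟨y, Or.inl rfl, e0 y⟩
      · have hs : ((x, 1) + (y, 1) : GaloisField 2 n × ZMod 2) = (x + y, 0) :=
          Prod.ext rfl (CharTwo.add_self_eq_zero _)
        exact ⟨x + y, Or.inr hs.symm, by rw [← cf_add_right, hs, e0]⟩
    obtain ⟨y, hy, ey⟩ := hrep q
    obtain ⟨z, hz, ez⟩ := hrep r
    rw [ey, ez] at h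
    have hyz : y = z := add_left_cancel (hf.injective (add_right_cancel h))
    subst hyz
    rcases hy with hy | hy <;> rcases hz with hz | hz
    · exact Or.inl (hz.symm.trans hy)
    · exact Or.inr (by rw [← hy, hz, add_add_cancel_point])
    · exact Or.inr (hz.symm.trans hy)
    · exact Or.inl (add_left_cancel (hz.symm.trans hy))

theorem Crooked.cf_surjective {n : ℕ} {f : GaloisField 2 n → GaloisField 2 n}
    (hf : Crooked n f) {p : GaloisField 2 n × ZMod 2} (hp : p ≠ 0) :
    Function.Surjective (cf n f p) := by
  classical
  have := Fintype.ofFinite (GaloisField 2 n)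
  have hle := Finset.card_le_mul_card_image (f := cf n f p) Finset.univ 2 (by
    intro c hc
    obtain ⟨q, -, rfl⟩ := Finset.mem_image.1 hc
    refine (Finset.card_le_card (t := {q, p + q}) fun r hr => ?_).trans Finset.card_le_two
    simpa using hf.eq_or_eq_add_of_cf_eq hp (Finset.mem_filter.1 hr).2.symm)
  rw [Finset.card_univ, Fintype.card_prod, ZMod.card, mul_comm] at hle
  have huniv := (Finset.card_eq_iff_eq_univ _).1
    (le_antisymm (Finset.card_le_univ _) (Nat.le_of_mul_le_mul_left hle two_pos))
  intro c
  obtain ⟨q, -, hq⟩ := Finset.mem_image.1 (huniv ▸ Finset.mem_univ c)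
  exact ⟨q, hq⟩

theorem Crooked.cf_ne_zero {n : ℕ} {f : GaloisField 2 n → GaloisField 2 n}
    (hf : Crooked n f) {p q : GaloisField 2 n × ZMod 2} (hp : p ≠ 0) (hq : q ≠ 0)
    (hqp : q ≠ p) : cf n f p q ≠ 0 := by
  intro h
  rcases hf.eq_or_eq_add_of_cf_eq hp ((cf_zero_right hf p).trans h.symm) with h | h
  · exact hq h
  · exact hqp (by rw [h, add_zero])

theorem ne_zero_and_ne_of_cf_ne_zero {n : ℕ} {f : GaloisField 2 n → GaloisField 2 n}
    (hf : Crooked n f) {p q : GaloisField 2 n × ZMod 2} (h : cf n f p q ≠ 0) :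
    q ≠ 0 ∧ q ≠ p :=
  ⟨fun h0 => h (h0 ▸ cf_zero_right hf p), fun h0 => h (h0 ▸ cf_self hf p)⟩

/-- A line can be rewritten with any of its points as the first generator. -/
theorem exists_line_eq_of_mem (n : ℕ) (f : GaloisField 2 n → GaloisField 2 n)
    {p a b : GaloisField 2 n × ZMod 2}
    (h : p ∈ ({a, b, a + b} : Set (GaloisField 2 n × ZMod 2))) :
    ∃ q, ({a, b, a + b} : Set (GaloisField 2 n × ZMod 2)) = {p, q, p + q} ∧
      cf n f p q = cf n f a b := by
  rcases h with rfl | rfl | rfl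
  · exact ⟨b, rfl, rfl⟩
  · exact ⟨a, by rw [Set.insert_comm, add_comm], cf_comm ..⟩
  · refine ⟨a, ?_, by rw [cf_comm, cf_add_right]⟩
    rw [add_comm (a + b) a, add_add_cancel_point]
    ext; simp only [Set.mem_insert_iff, Set.mem_singleton_iff]; tauto

theorem stmt_7 (n : ℕ) (hn : 0 < n) (f : GaloisField 2 n → GaloisField 2 n)
    (hf : Crooked n f) :
    (∀ p : GaloisField 2 n × ZMod 2, p ≠ 0 →
      ∀ q r : GaloisField 2 n × ZMod 2, q ≠ 0 → q ≠ p → r ≠ 0 → r ≠ p →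
        r ≠ q → r ≠ p + q → cf n f p q ≠ cf n f p r) ∧
    (∀ p : GaloisField 2 n × ZMod 2, p ≠ 0 →
      {c : GaloisField 2 n | ∃ q, q ≠ 0 ∧ q ≠ p ∧ cf n f p q = c} =
        {c : GaloisField 2 n | c ≠ 0}) ∧
    (∀ γ : GaloisField 2 n, γ ≠ 0 → ∀ p : GaloisField 2 n × ZMod 2, p ≠ 0 →
      ∃! L : Set (GaloisField 2 n × ZMod 2),
        (∃ a b : GaloisField 2 n × ZMod 2, a ≠ 0 ∧ b ≠ 0 ∧ a ≠ b ∧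
          L = {a, b, a + b} ∧ cf n f a b = γ) ∧ p ∈ L) := by
  refine ⟨fun p hp q r _ _ _ _ hrq hrpq h => ?_, fun p hp => ?_, fun γ hγ p hp => ?_⟩
  · exact (hf.eq_or_eq_add_of_cf_eq hp h).elim hrq hrpq
  · ext c
    constructor
    · rintro ⟨q, hq, hqp, rfl⟩
      exact hf.cf_ne_zero hp hq hqp
    · intro hc
      obtain ⟨q, rfl⟩ := hf.cf_surjective hp c
      obtain ⟨hq, hqp⟩ := ne_zero_and_ne_of_cf_ne_zero hf hc
      exact ⟨q, hq, hqp, rfl⟩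
  · obtain ⟨q, rfl⟩ := hf.cf_surjective hp γ
    obtain ⟨hq, hqp⟩ := ne_zero_and_ne_of_cf_ne_zero hf hγ
    refine ⟨{p, q, p + q}, ⟨⟨p, q, hp, hq, hqp.symm, rfl, rfl⟩, Set.mem_insert ..⟩, ?_⟩
    rintro _ ⟨⟨a, b, -, -, -, rfl, hab⟩, hpL⟩
    obtain ⟨r, hL, hr⟩ := exists_line_eq_of_mem n f hpL
    rw [hL]
    rcases hf.eq_or_eq_add_of_cf_eq hp (hr.trans hab).symm with rfl | rfl
    · rfl
    · rw [add_add_cancel_point, Set.pair_comm]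
end

section
/- Let f and f' be crooked functions over K = F_{2^n} that are linearly equivalent, i.e. f'(x) = L₁(f(L₂(x))) for all x ∈ K, where L₁, L₂ are F_2-linear bijections of K. Then the parallelisms Π_f and Π_{f'} induced by c_f and c_{f'} are equivalent: there exist a bijection σ of K with σ(0) = 0 and an F_2-linear bijection κ of K × F_2 such that σ(c_{f'}(p, q)) = c_f(κ(p), κ(q)) for all p, q ∈ K × F_2. -/
theorem stmt_8 (n : ℕ) (hn : 0 < n) (f f' : GaloisField 2 n → GaloisField 2 n)
    (hf : Crooked n f) (hf' : Crooked n f')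
    (L₁ L₂ : GaloisField 2 n →ₗ[ZMod 2] GaloisField 2 n)
    (hL₁ : Function.Bijective L₁) (hL₂ : Function.Bijective L₂)
    (heq : ∀ x : GaloisField 2 n, f' x = L₁ (f (L₂ x))) :
    ∃ (σ : GaloisField 2 n → GaloisField 2 n)
      (κ : (GaloisField 2 n × ZMod 2) →ₗ[ZMod 2] (GaloisField 2 n × ZMod 2)),
      Function.Bijective σ ∧ σ 0 = 0 ∧ Function.Bijective κ ∧
      ∀ p q : GaloisField 2 n × ZMod 2, σ (cf n f' p q) = cf n f (κ p) (κ q) := by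
  let e := LinearEquiv.ofBijective L₁ hL₁
  refine ⟨e.symm, L₂.prodMap LinearMap.id, e.symm.bijective, map_zero e.symm,
    hL₂.prodMap Function.bijective_id, fun p q => ?_⟩
  rw [LinearEquiv.symm_apply_eq]
  simp [e, cf, heq]
end

section
/- Let n > 1 be odd and let f be a crooked function over K = F_{2^n}. Then for every a ∈ K ∖ {0}, the image set {B_f(a, y) : y ∈ K} is an F_2-linear subspace of K of dimension n − 1 over F_2, and the map a ↦ {B_f(a, y) : y ∈ K} is injective on K ∖ {0}. -/
namespace Crooked

open Finset

variable {K : Type*} [Field K] [Fintype K] [DecidableEq K] [CharP K 2]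

/-- The image of `y ↦ f (a + y) + f a + f y` as a finite set. -/
def polarImage (f : K → K) (a : K) : Finset K :=
  univ.image fun y => f (a + y) + f a + f y

theorem filter_polar_eq {f : K → K}
    (h : ∀ x y z : K, x ≠ y → y ≠ z → x ≠ z → f x + f y + f z + f (x + y + z) ≠ 0)
    {a : K} (ha : a ≠ 0) (x : K) :
    (univ.filter fun y => f (a + y) + f a + f y = f (a + x) + f a + f x) = {x, a + x} := by
  ext y
  simp only [mem_filter, mem_univ, true_and, mem_insert, mem_singleton]
  constructor
  · intro hy
    by_contra! hne
    have hax : x ≠ a + x := fun e => ha (by grind)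
    refine h x (a + x) y hax hne.2.symm hne.1.symm ?_
    have e : x + (a + x) + y = a + y := by grind
    rw [e]
    grind
  · rintro (rfl | rfl)
    · rfl
    · have e : a + (a + x) = x := by grind
      rw [e]
      ring

theorem card_filter_polar_eq {f : K → K}
    (h : ∀ x y z : K, x ≠ y → y ≠ z → x ≠ z → f x + f y + f z + f (x + y + z) ≠ 0)
    {a : K} (ha : a ≠ 0) {b : K} (hb : b ∈ polarImage f a) :
    #(univ.filter fun y => f (a + y) + f a + f y = b) = 2 := by
  obtain ⟨x, -, rfl⟩ := mem_image.1 hb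
  rw [filter_polar_eq h ha x, card_pair]
  exact fun e => ha (by grind)

/-- Summing over the argument of the polar form counts every value twice. -/
theorem sum_polar {f : K → K}
    (h : ∀ x y z : K, x ≠ y → y ≠ z → x ≠ z → f x + f y + f z + f (x + y + z) ≠ 0)
    {a : K} (ha : a ≠ 0) (g : K → ℤ) :
    ∑ y, g (f (a + y) + f a + f y) = 2 * ∑ b ∈ polarImage f a, g b := by
  rw [sum_comp g fun y => f (a + y) + f a + f y, mul_sum]
  refine sum_congr rfl fun b hb => ?_
  rw [card_filter_polar_eq h ha hb, nsmul_eq_mul]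
  rfl

theorem two_mul_card_polarImage {f : K → K}
    (h : ∀ x y z : K, x ≠ y → y ≠ z → x ≠ z → f x + f y + f z + f (x + y + z) ≠ 0)
    {a : K} (ha : a ≠ 0) : 2 * #(polarImage f a) = Fintype.card K := by
  have := sum_polar h ha fun _ => 1
  simp only [sum_const, card_univ, nsmul_eq_mul, mul_one] at this
  exact_mod_cast this.symm

theorem zero_mem_polarImage {f : K → K} (h0 : f 0 = 0) (a : K) : 0 ∈ polarImage f a :=
  mem_image.2 ⟨0, mem_univ _, by rw [add_zero, h0]; grind⟩

theorem add_add_ne_of_mem_polarImage {f : K → K}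
    (h : ∀ a : K, a ≠ 0 → ∀ x y z : K,
      f x + f y + f z + f (x + a) + f (y + a) + f (z + a) ≠ 0)
    {a : K} (ha : a ≠ 0) {b c d : K} (hb : b ∈ polarImage f a) (hc : c ∈ polarImage f a)
    (hd : d ∈ polarImage f a) : b + c + d ≠ f a := by
  obtain ⟨x, -, rfl⟩ := mem_image.1 hb
  obtain ⟨y, -, rfl⟩ := mem_image.1 hc
  obtain ⟨z, -, rfl⟩ := mem_image.1 hd
  intro e
  refine h a ha x y z ?_
  rw [add_comm x, add_comm y, add_comm z]
  grind

/-- The image of the polar form and its translate by `f a` partition the field. -/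
theorem add_mem_polarImage_iff {f : K → K} (h0 : f 0 = 0)
    (h1 : ∀ x y z : K, x ≠ y → y ≠ z → x ≠ z → f x + f y + f z + f (x + y + z) ≠ 0)
    (h2 : ∀ a : K, a ≠ 0 → ∀ x y z : K,
      f x + f y + f z + f (x + a) + f (y + a) + f (z + a) ≠ 0)
    {a : K} (ha : a ≠ 0) (x : K) : x + f a ∈ polarImage f a ↔ x ∉ polarImage f a := by
  have hsub : (polarImage f a).map (addRightEmbedding (f a)) ⊆ (polarImage f a)ᶜ := by
    intro y hy
    obtain ⟨b, hb, rfl⟩ := mem_map.1 hy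
    rw [mem_compl]
    intro hc
    refine add_add_ne_of_mem_polarImage h2 ha hb hc (zero_mem_polarImage h0 a) ?_
    simp only [addRightEmbedding_apply]
    grind
  have heq := eq_of_subset_of_card_le hsub (by
    have := two_mul_card_polarImage h1 ha
    rw [card_compl, card_map]
    lia)
  rw [← mem_compl, ← heq, mem_map]
  constructor
  · intro hx
    exact ⟨_, hx, by simp only [addRightEmbedding_apply]; grind⟩
  · rintro ⟨b, hb, rfl⟩
    have e : b + f a + f a = b := by grind
    simpa only [addRightEmbedding_apply, e] using hb

theorem add_mem_polarImage {f : K → K} (h0 : f 0 = 0)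
    (h1 : ∀ x y z : K, x ≠ y → y ≠ z → x ≠ z → f x + f y + f z + f (x + y + z) ≠ 0)
    (h2 : ∀ a : K, a ≠ 0 → ∀ x y z : K,
      f x + f y + f z + f (x + a) + f (y + a) + f (z + a) ≠ 0)
    {a : K} (ha : a ≠ 0) {b c : K} (hb : b ∈ polarImage f a) (hc : c ∈ polarImage f a) :
    b + c ∈ polarImage f a := by
  by_contra hbc
  refine add_add_ne_of_mem_polarImage h2 ha hb hc
    ((add_mem_polarImage_iff h0 h1 h2 ha _).2 hbc) ?_
  grind

/-- The `±1`-valued character whose kernel is the image of the polar form. -/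
def polarSign (f : K → K) (a v : K) : ℤ :=
  if v ∈ polarImage f a then 1 else -1

theorem polarSign_add {f : K → K} (h0 : f 0 = 0)
    (h1 : ∀ x y z : K, x ≠ y → y ≠ z → x ≠ z → f x + f y + f z + f (x + y + z) ≠ 0)
    (h2 : ∀ a : K, a ≠ 0 → ∀ x y z : K,
      f x + f y + f z + f (x + a) + f (y + a) + f (z + a) ≠ 0)
    {a : K} (ha : a ≠ 0) (u v : K) :
    polarSign f a (u + v) = polarSign f a u * polarSign f a v := by
  have hadd := @add_mem_polarImage K _ _ _ _ f h0 h1 h2 a ha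
  have hshift := add_mem_polarImage_iff h0 h1 h2 ha
  have key : u + v ∈ polarImage f a ↔ (u ∈ polarImage f a ↔ v ∈ polarImage f a) := by
    by_cases hu : u ∈ polarImage f a <;> by_cases hv : v ∈ polarImage f a
    · simp [hu, hv, hadd hu hv]
    · simp only [hu, hv, iff_false, not_true]
      intro huv
      have e : u + (u + v) = v := by grind
      exact hv (e ▸ hadd hu huv)
    · simp only [hu, hv, iff_true]
      refine iff_of_false (fun huv => ?_) id
      have e : u + v + v = u := by grind
      exact hu (e ▸ hadd huv hv)
    · simp only [hu, hv, iff_true]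
      have e : u + f a + (v + f a) = u + v := by grind
      exact e ▸ hadd ((hshift u).2 hu) ((hshift v).2 hv)
  unfold polarSign
  by_cases hu : u ∈ polarImage f a <;> by_cases hv : v ∈ polarImage f a <;> simp [key, hu, hv]

/-- The autocorrelation of `polarSign f a ∘ f` at `d`, when `a` and `d` have the same image. -/
theorem sum_polarSign_of_eq {f : K → K} (h0 : f 0 = 0)
    (h1 : ∀ x y z : K, x ≠ y → y ≠ z → x ≠ z → f x + f y + f z + f (x + y + z) ≠ 0)
    (h2 : ∀ a : K, a ≠ 0 → ∀ x y z : K,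
      f x + f y + f z + f (x + a) + f (y + a) + f (z + a) ≠ 0)
    {a d : K} (hd : d ≠ 0) (had : polarImage f d = polarImage f a) :
    ∑ x, polarSign f a (f x + f (d + x)) = -Fintype.card K := by
  have hterm (x : K) : polarSign f a (f x + f (d + x)) = -1 := by
    have hmem : f (d + x) + f d + f x ∈ polarImage f d := mem_image.2 ⟨x, mem_univ _, rfl⟩
    refine if_neg ?_
    rw [← had, ← add_mem_polarImage_iff h0 h1 h2 hd]
    convert hmem using 1
    ring
  simp [hterm]

/-- The autocorrelation of `polarSign f a ∘ f` at `d`, when `a` and `d` have distinct images. -/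
theorem sum_polarSign_of_ne {f : K → K} (h0 : f 0 = 0)
    (h1 : ∀ x y z : K, x ≠ y → y ≠ z → x ≠ z → f x + f y + f z + f (x + y + z) ≠ 0)
    (h2 : ∀ a : K, a ≠ 0 → ∀ x y z : K,
      f x + f y + f z + f (x + a) + f (y + a) + f (z + a) ≠ 0)
    {a d : K} (ha : a ≠ 0) (hd : d ≠ 0) (had : polarImage f d ≠ polarImage f a) :
    ∑ x, polarSign f a (f x + f (d + x)) = 0 := by
  obtain ⟨c, hcd, hca⟩ : ∃ c ∈ polarImage f d, c ∉ polarImage f a := by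
    by_contra! hsub
    refine had (eq_of_subset_of_card_le hsub ?_)
    have := two_mul_card_polarImage h1 ha
    have := two_mul_card_polarImage h1 hd
    lia
  have hzero : ∑ b ∈ polarImage f d, polarSign f a b = 0 := by
    have hneg : ∑ b ∈ polarImage f d, polarSign f a b =
        ∑ b ∈ polarImage f d, -polarSign f a b := by
      refine sum_equiv (Equiv.addRight c) (fun b => ?_) fun b _ => ?_
      · refine ⟨fun hb => add_mem_polarImage h0 h1 h2 hd hb hcd, fun hb => ?_⟩
        have e : b + c + c = b := by grind
        exact e ▸ add_mem_polarImage h0 h1 h2 hd hb hcd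
      · have hc : polarSign f a c = -1 := if_neg hca
        simp [polarSign_add h0 h1 h2 ha, hc]
    rw [sum_neg_distrib] at hneg
    lia
  have hterm (x : K) : polarSign f a (f x + f (d + x)) =
      polarSign f a (f d) * polarSign f a (f (d + x) + f d + f x) := by
    rw [← polarSign_add h0 h1 h2 ha]
    congr 1
    grind
  simp only [hterm]
  rw [← mul_sum, sum_polar h1 hd, hzero]
  simp

theorem polarImage_injOn {f : K → K} (h0 : f 0 = 0)
    (h1 : ∀ x y z : K, x ≠ y → y ≠ z → x ≠ z → f x + f y + f z + f (x + y + z) ≠ 0)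
    (h2 : ∀ a : K, a ≠ 0 → ∀ x y z : K,
      f x + f y + f z + f (x + a) + f (y + a) + f (z + a) ≠ 0) :
    Set.InjOn (polarImage f) {a | a ≠ 0} := by
  intro a ha b hb hab
  by_contra hne
  have hsq : (∑ x, polarSign f a (f x)) ^ 2 = ∑ d, ∑ x, polarSign f a (f x + f (d + x)) := by
    rw [sq, sum_mul_sum, sum_comm (f := fun d x => polarSign f a (f x + f (d + x)))]
    refine sum_congr rfl fun x _ => ?_
    simp only [← polarSign_add h0 h1 h2 ha]
    exact (Equiv.sum_comp (Equiv.addRight x) fun y => polarSign f a (f x + f y)).symm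
  have hrest : ∑ d ∈ ({0, a, b} : Finset K)ᶜ, ∑ x, polarSign f a (f x + f (d + x)) ≤ 0 := by
    refine sum_nonpos fun d hd => ?_
    have hd0 : d ≠ 0 := by
      rintro rfl
      simp at hd
    by_cases had : polarImage f d = polarImage f a
    · rw [sum_polarSign_of_eq h0 h1 h2 hd0 had]
      simp
    · rw [sum_polarSign_of_ne h0 h1 h2 ha hd0 had]
  have hT0 : ∑ x, polarSign f a (f x + f (0 + x)) = Fintype.card K := by
    have hterm (x : K) : polarSign f a (f x + f (0 + x)) = 1 := by
      rw [zero_add, CharTwo.add_self_eq_zero]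
      exact if_pos (zero_mem_polarImage h0 a)
    simp only [hterm]
    simp
  rw [← sum_add_sum_compl {0, a, b} fun d => ∑ x, polarSign f a (f x + f (d + x)), sum_insert (by simp [Ne.symm ha, Ne.symm hb]),
    sum_pair hne, hT0, sum_polarSign_of_eq h0 h1 h2 ha rfl,
    sum_polarSign_of_eq h0 h1 h2 hb hab.symm] at hsq
  have hpos : 0 < (Fintype.card K : ℤ) := by exact_mod_cast Fintype.card_pos
  nlinarith [sq_nonneg (∑ x, polarSign f a (f x))]

end Crooked

theorem stmt_9 (n : ℕ) (hn : 1 < n) (hodd : Odd n)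
    (f : GaloisField 2 n → GaloisField 2 n) (hf : Crooked n f) :
    (∀ a : GaloisField 2 n, a ≠ 0 →
      ∃ W : Submodule (ZMod 2) (GaloisField 2 n),
        (W : Set (GaloisField 2 n)) = Set.range (fun y => Bf n f a y) ∧
        Module.finrank (ZMod 2) W = n - 1) ∧
    Set.InjOn (fun a => Set.range (fun y => Bf n f a y))
      {a : GaloisField 2 n | a ≠ 0} := by
  classical
  have : Fintype (GaloisField 2 n) := Fintype.ofFinite _
  obtain ⟨h0, h1, h2⟩ := hf
  have hrange (a : GaloisField 2 n) :
      Set.range (fun y => Bf n f a y) = Crooked.polarImage f a := by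
    simp [Crooked.polarImage, Bf]
  constructor
  · intro a ha
    let W : AddSubgroup (GaloisField 2 n) :=
      { carrier := Crooked.polarImage f a
        add_mem' := fun hb hc => Crooked.add_mem_polarImage h0 h1 h2 ha hb hc
        zero_mem' := Crooked.zero_mem_polarImage h0 a
        neg_mem' := fun {b} hb => by rwa [CharTwo.neg_eq] }
    refine ⟨AddSubgroup.toZModSubmodule 2 W, (hrange a).symm, ?_⟩
    have hcard := Crooked.two_mul_card_polarImage h1 ha
    have hW : Nat.card (AddSubgroup.toZModSubmodule 2 W) = (Crooked.polarImage f a).card :=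
      Nat.card_eq_card_toFinset _ |>.trans (by
        congr 1
        ext
        rw [Set.mem_toFinset]
        exact Finset.mem_coe)
    rw [← hW, ← Nat.card_eq_fintype_card, GaloisField.card 2 n (by lia),
      Module.natCard_eq_pow_finrank (K := ZMod 2), Nat.card_zmod, ← pow_succ'] at hcard
    have := Nat.pow_right_injective le_rfl hcard
    lia
  · intro a ha b hb hab
    simp only [hrange] at hab
    exact Crooked.polarImage_injOn h0 h1 h2 ha hb (Finset.coe_injective hab)
end

section
/- Let n > 3 and let f be a quadratic crooked function over K = F_{2^n}. For every F_2-linear subspace C of K with dim_{F_2} C = n − 2, there exists a color γ ∈ K ∖ {0} such that some line contained in C has color γ but some line contained in K and not contained in C also has color γ: that is, there exist distinct nonzero a, b ∈ C with B_f(a, b) = γ, and distinct nonzero u, v ∈ K with not all of u, v, u+v lying in C and B_f(u, v) = γ. -/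
/-- The linear map `y ↦ B_f(a, y)` attached to a quadratic function `f`. -/
noncomputable def bfLinear {n : ℕ} {f : GaloisField 2 n → GaloisField 2 n}
    (hquad : IsQuadratic n f) (a : GaloisField 2 n) :
    GaloisField 2 n →ₗ[ZMod 2] GaloisField 2 n :=
  (AddMonoidHom.mk' (Bf n f a) (hquad.2 a)).toZModLinearMap 2

theorem bfLinear_apply {n : ℕ} {f : GaloisField 2 n → GaloisField 2 n}
    (hquad : IsQuadratic n f) (a x : GaloisField 2 n) :
    bfLinear hquad a x = Bf n f a x := rfl

theorem Crooked.bf_ne_zero {n : ℕ} {f : GaloisField 2 n → GaloisField 2 n}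
    (hf : Crooked n f) {a b : GaloisField 2 n} (ha : a ≠ 0) (hb : b ≠ 0) (hab : a ≠ b) :
    Bf n f a b ≠ 0 := by
  have h := hf.2.1 a b 0 hab hb ha
  rw [hf.1, add_zero, add_zero] at h
  intro h0
  apply h
  rw [← h0, Bf]
  ring

theorem Crooked.bf_self {n : ℕ} {f : GaloisField 2 n → GaloisField 2 n}
    (hf : Crooked n f) (a : GaloisField 2 n) : Bf n f a a = 0 := by
  rw [Bf, CharTwo.add_self_eq_zero, hf.1, zero_add, CharTwo.add_self_eq_zero]

theorem Crooked.notMem_range_bfLinear {n : ℕ} {f : GaloisField 2 n → GaloisField 2 n}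
    (hf : Crooked n f) (hquad : IsQuadratic n f) {a : GaloisField 2 n} (ha : a ≠ 0) :
    f a ∉ LinearMap.range (bfLinear hquad a) := by
  rintro ⟨x, hx⟩
  rw [bfLinear_apply, Bf, add_comm a x] at hx
  have h := hf.2.2 a ha x 0 0
  rw [hf.1, zero_add] at h
  apply h
  linear_combination hx + CharTwo.add_self_eq_zero (f a)

theorem Crooked.range_bfLinear_sup_span {n : ℕ}
    {f : GaloisField 2 n → GaloisField 2 n}
    (hf : Crooked n f) (hquad : IsQuadratic n f) {a : GaloisField 2 n} (ha : a ≠ 0) :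
    LinearMap.range (bfLinear hquad a) ⊔ Submodule.span (ZMod 2) {f a} = ⊤ := by
  have hker : LinearMap.ker (bfLinear hquad a) ≤ Submodule.span (ZMod 2) {a} := by
    intro x hx
    rw [LinearMap.mem_ker, bfLinear_apply] at hx
    by_cases hx0 : x = 0
    · simp [hx0]
    by_cases hxa : a = x
    · simp [← hxa]
    exact absurd hx (hf.bf_ne_zero ha hx0 hxa)
  have hk := (Submodule.finrank_mono hker).trans (finrank_span_singleton ha).le
  have hrn := LinearMap.finrank_range_add_finrank_ker (bfLinear hquad a)
  have hlt : LinearMap.range (bfLinear hquad a) <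
      LinearMap.range (bfLinear hquad a) ⊔ Submodule.span (ZMod 2) {f a} :=
    lt_of_le_of_ne le_sup_left fun h => hf.notMem_range_bfLinear hquad ha
      (h ▸ Submodule.mem_sup_right (Submodule.mem_span_singleton_self _))
  have h := Submodule.finrank_lt_finrank_of_lt hlt
  apply Submodule.eq_top_of_finrank_eq
  have := Submodule.finrank_le
    (LinearMap.range (bfLinear hquad a) ⊔ Submodule.span (ZMod 2) {f a})
  omega

theorem Crooked.dual_apply_eq_one {n : ℕ}
    {f : GaloisField 2 n → GaloisField 2 n}
    (hf : Crooked n f) (hquad : IsQuadratic n f) {a : GaloisField 2 n} (ha : a ≠ 0)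
    {l : Module.Dual (ZMod 2) (GaloisField 2 n)} (hl : l ≠ 0)
    (h : ∀ x, l (Bf n f a x) = 0) : l (f a) = 1 := by
  refine Fin.eq_one_of_ne_zero _ fun h0 => hl ?_
  rw [← LinearMap.ker_eq_top, eq_top_iff, ← hf.range_bfLinear_sup_span hquad ha, sup_le_iff,
    Submodule.span_singleton_le_iff_mem]
  exact ⟨by rintro _ ⟨x, rfl⟩; exact h x, h0⟩

/-- A nonzero functional annihilates `B_f(a, ·)` for at most one nonzero `a`. -/
theorem Crooked.eq_of_dual_annihilates {n : ℕ}
    {f : GaloisField 2 n → GaloisField 2 n}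
    (hf : Crooked n f) (hquad : IsQuadratic n f) {a b : GaloisField 2 n}
    (ha : a ≠ 0) (hb : b ≠ 0)
    {l : Module.Dual (ZMod 2) (GaloisField 2 n)} (hl : l ≠ 0)
    (hla : ∀ x, l (Bf n f a x) = 0) (hlb : ∀ x, l (Bf n f b x) = 0) : a = b := by
  by_contra hab
  have hc : a + b ≠ 0 := fun h => hab (CharTwo.add_eq_zero.mp h)
  have h1 := hf.dual_apply_eq_one hquad ha hl hla
  have h2 := hf.dual_apply_eq_one hquad hb hl hlb
  have h3 := hf.dual_apply_eq_one hquad hc hl fun x => by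
    rw [hquad.1, map_add, hla, hlb, add_zero]
  have h4 := hla b
  rw [Bf, map_add, map_add, h1, h2, h3] at h4
  exact absurd h4 (by decide)

/-- If a set of nonzero vectors `u` all have `γ` outside the image of `B_f(u, ·)`, then it has at
most `2 ^ (n - 1)` elements. -/
theorem Crooked.card_mul_two_le {n : ℕ} (hn : n ≠ 0)
    {f : GaloisField 2 n → GaloisField 2 n}
    (hf : Crooked n f) (hquad : IsQuadratic n f) (γ : GaloisField 2 n)
    (S : Set (GaloisField 2 n)) (hS0 : 0 ∉ S) (hS : ∀ u ∈ S, ∀ v, Bf n f u v ≠ γ) :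
    Nat.card S * 2 ≤ 2 ^ n := by
  have key (u : S) : ∃ l : Module.Dual (ZMod 2) (GaloisField 2 n),
      l γ = 1 ∧ ∀ x, l (Bf n f u x) = 0 := by
    have hγ : γ ∉ LinearMap.range (bfLinear hquad u) := by
      rintro ⟨v, hv⟩
      exact hS u u.2 v hv
    obtain ⟨l, hlγ, hl⟩ := Submodule.exists_le_ker_of_notMem hγ
    exact ⟨l, Fin.eq_one_of_ne_zero _ hlγ, fun x => hl ⟨x, rfl⟩⟩
  choose l hlγ hl using key
  have hcard : Nat.card (Module.Dual (ZMod 2) (GaloisField 2 n)) = 2 ^ n := by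
    rw [Module.natCard_eq_pow_finrank (K := ZMod 2), Subspace.dual_finrank_eq,
      GaloisField.finrank 2 hn, Nat.card_zmod]
  rcases isEmpty_or_nonempty S with hE | ⟨⟨u₀⟩⟩
  · simp
  have hinj : Function.Injective fun p : S × ZMod 2 => l p.1 + p.2 • l u₀ := by
    rintro ⟨u, c⟩ ⟨v, d⟩ h
    have hcd : c = d := by
      simpa [hlγ] using LinearMap.congr_fun h γ
    subst hcd
    have huv : l u = l v := by simpa using h
    have hne : l u ≠ 0 := fun h0 => by simpa [h0] using hlγ u
    have := hf.eq_of_dual_annihilates hquad (fun h => hS0 (h ▸ u.2)) (fun h => hS0 (h ▸ v.2))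
      hne (hl u) (huv ▸ hl v)
    exact Prod.ext (Subtype.ext this) rfl
  have : Finite (Module.Dual (ZMod 2) (GaloisField 2 n)) :=
    Module.finite_of_finite (ZMod 2)
  have h := Nat.card_le_card_of_injective _ hinj
  rwa [Nat.card_prod, Nat.card_zmod, hcard] at h

theorem stmt_10 (n : ℕ) (hn : 3 < n)
    (f : GaloisField 2 n → GaloisField 2 n)
    (hf : Crooked n f) (hquad : IsQuadratic n f)
    (C : Submodule (ZMod 2) (GaloisField 2 n))
    (hC : Module.finrank (ZMod 2) C = n - 2) :
    ∃ γ : GaloisField 2 n, γ ≠ 0 ∧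
      (∃ a b : GaloisField 2 n, a ∈ C ∧ b ∈ C ∧ a ≠ 0 ∧ b ≠ 0 ∧ a ≠ b ∧
        Bf n f a b = γ) ∧
      (∃ u v : GaloisField 2 n, u ≠ 0 ∧ v ≠ 0 ∧ u ≠ v ∧
        ¬(u ∈ C ∧ v ∈ C ∧ u + v ∈ C) ∧ Bf n f u v = γ) := by
  have hn0 : n ≠ 0 := by omega
  have hcardC : Nat.card C = 2 ^ (n - 2) := by
    rw [Module.natCard_eq_pow_finrank (K := ZMod 2), hC, Nat.card_zmod]
  have hpow : 2 ^ n = 4 * 2 ^ (n - 2) := by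
    obtain ⟨m, rfl⟩ := Nat.exists_eq_add_of_le' (show 2 ≤ n by omega)
    rw [Nat.add_sub_cancel, pow_add, mul_comm]
    rfl
  have hC4 : 2 ^ 2 ≤ 2 ^ (n - 2) := Nat.pow_le_pow_right two_pos (by omega)
  obtain ⟨a, ha, b, hb, ha0, hb0, hab⟩ : ∃ a ∈ C, ∃ b ∈ C, a ≠ 0 ∧ b ≠ 0 ∧ a ≠ b := by
    have : 2 < (C : Set (GaloisField 2 n)).ncard := by
      rw [← Nat.card_coe_set_eq]
      exact lt_of_lt_of_le (by omega) hcardC.ge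
    have h1 : 1 < ((C : Set (GaloisField 2 n)) \ {0}).ncard := by
      rw [Set.ncard_sdiff_singleton_of_mem C.zero_mem]
      omega
    obtain ⟨a, ha, b, hb, hab⟩ := (Set.one_lt_ncard (Set.toFinite _)).mp h1
    exact ⟨a, ha.1, b, hb.1, ha.2, hb.2, hab⟩
  have hγ := hf.bf_ne_zero ha0 hb0 hab
  refine ⟨Bf n f a b, hγ, ⟨a, b, ha, hb, ha0, hb0, hab, rfl⟩, ?_⟩
  obtain ⟨u, hu, v, huv⟩ : ∃ u ∉ C, ∃ v, Bf n f u v = Bf n f a b := by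
    by_contra! hno
    have h := hf.card_mul_two_le hn0 hquad (Bf n f a b) (C : Set (GaloisField 2 n))ᶜ
      (fun h => h C.zero_mem) hno
    have hadd := Set.ncard_add_ncard_compl (C : Set (GaloisField 2 n))
    rw [← Nat.card_coe_set_eq, ← Nat.card_coe_set_eq, GaloisField.card 2 n hn0] at hadd
    have : Nat.card (C : Set (GaloisField 2 n)) = 2 ^ (n - 2) := hcardC
    omega
  refine ⟨u, v, fun h => hu (h ▸ C.zero_mem), ?_, ?_, fun h => hu h.1, huv⟩
  · rintro rfl
    exact hγ (huv ▸ map_zero (bfLinear hquad u))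
  · rintro rfl
    exact hγ (huv ▸ hf.bf_self u)
end

section
/- Let f be a quadratic crooked function over K = F_{2^n} with n > 1 odd. For any two colors γ₁, γ₂ ∈ K ∖ {0} there are intersecting lines inside the hyperplane K × {0} with these colors: there exist nonzero x, y, z ∈ K such that B_f(x, y) = γ₁ and B_f(x, z) = γ₂. -/
/-- An alternating matrix of odd size, over any commutative ring, has determinant zero. -/
theorem Matrix.det_eq_zero_of_alternating_of_odd_card {ι R : Type*} [Fintype ι] [DecidableEq ι]
    [CommRing R] (M : Matrix ι ι R) (hdiag : ∀ i, M i i = 0) (hskew : ∀ i j, M i j = -M j i)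
    (hodd : Odd (Fintype.card ι)) : M.det = 0 := by
  rw [Matrix.det_apply']
  refine Finset.sum_involution (fun σ _ => σ⁻¹) ?_ ?_ (fun _ _ => Finset.mem_univ _)
    (fun σ _ => inv_inv σ)
  · intro σ _
    have h : ∏ i, M (σ⁻¹ i) i = -∏ i, M (σ i) i := by
      rw [← Equiv.prod_comp σ fun i => M (σ⁻¹ i) i]
      simp only [Equiv.Perm.inv_def, Equiv.symm_apply_apply]
      rw [Finset.prod_congr rfl fun i _ => hskew i (σ i), Finset.prod_neg, Finset.card_univ,
        hodd.neg_one_pow, neg_one_mul]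
    rw [h, Equiv.Perm.sign_inv]
    ring
  · intro σ _ hne hinv
    have hpow : σ ^ 2 ^ 1 = 1 := by
      rw [pow_one, pow_two]
      nth_rewrite 1 [← hinv]
      exact inv_mul_cancel σ
    obtain ⟨i, hi⟩ := Equiv.Perm.exists_fixed_point_of_prime (p := 2)
      hodd.not_two_dvd_nat hpow
    exact hne (by rw [Finset.prod_eq_zero (Finset.mem_univ i) (by rw [hi, hdiag]), mul_zero])

/-- An alternating bilinear form on an odd-dimensional vector space has a nonzero radical. -/
theorem LinearMap.IsAlt.exists_ne_zero_forall_apply_eq_zero {F V : Type*} [Field F]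
    [AddCommGroup V] [Module F V] {B : V →ₗ[F] V →ₗ[F] F} (hB : B.IsAlt)
    (hodd : Odd (Module.finrank F V)) : ∃ x, x ≠ 0 ∧ ∀ y, B x y = 0 := by
  have : Module.Finite F V := Module.finite_of_finrank_pos hodd.pos
  let b := Module.finBasis F V
  have hdet : (LinearMap.toMatrix₂ b b B).det = 0 := by
    refine Matrix.det_eq_zero_of_alternating_of_odd_card _ (fun i => ?_) (fun i j => ?_)
      (by rwa [Fintype.card_fin])
    · simpa only [LinearMap.toMatrix₂_apply] using hB (b i)
    · simpa only [LinearMap.toMatrix₂_apply] using (hB.neg (b j) (b i)).symm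
  by_contra! h
  refine (LinearMap.separatingLeft_iff_det_ne_zero b).1 (fun x hx => ?_) hdet
  by_contra hx0
  obtain ⟨y, hy⟩ := h x hx0
  exact hy (hx y)

/-- Two vectors in a space of dimension at least three are killed by a common nonzero functional. -/
theorem exists_dual_ne_zero_apply_eq_zero_pair {F V : Type*} [Field F] [AddCommGroup V]
    [Module F V] (h : 2 < Module.finrank F V) (v w : V) :
    ∃ φ : V →ₗ[F] F, φ ≠ 0 ∧ φ v = 0 ∧ φ w = 0 := by
  classical
  have hlt : Submodule.span F {v, w} < ⊤ := by
    refine lt_of_le_of_ne le_top fun htop => ?_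
    have h2 := finrank_span_le_card (R := F) ({v, w} : Set V)
    rw [htop, finrank_top] at h2
    have h3 : ({v, w} : Set V).toFinset.card ≤ 2 := by
      simpa using Finset.card_le_two (a := v) (b := w)
    omega
  obtain ⟨φ, hφ, hle⟩ := Submodule.exists_le_ker_of_lt_top _ hlt
  exact ⟨φ, hφ, hle (Submodule.subset_span (by simp)), hle (Submodule.subset_span (by simp))⟩

/-- The bilinear map over `F_2` given by `B_f` for quadratic `f`. -/
noncomputable def IsQuadratic.bilin {n : ℕ} {f : GaloisField 2 n → GaloisField 2 n}
    (hf : IsQuadratic n f) :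
    GaloisField 2 n →ₗ[ZMod 2] GaloisField 2 n →ₗ[ZMod 2] GaloisField 2 n :=
  (AddMonoidHom.mk' (fun x => (AddMonoidHom.mk' (Bf n f x) (hf.2 x)).toZModLinearMap 2)
    fun x y => LinearMap.ext fun z => hf.1 x y z).toZModLinearMap 2

theorem IsQuadratic.bilin_apply {n : ℕ} {f : GaloisField 2 n → GaloisField 2 n}
    (hf : IsQuadratic n f) (x y : GaloisField 2 n) : hf.bilin x y = Bf n f x y :=
  rfl

theorem Crooked.Bf_self {n : ℕ} {f : GaloisField 2 n → GaloisField 2 n} (hf : Crooked n f)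
    (x : GaloisField 2 n) : Bf n f x x = 0 := by
  rw [Bf, CharTwo.add_self_eq_zero, hf.1, zero_add, CharTwo.add_self_eq_zero]

theorem Crooked.eq_zero_or_eq_of_Bf_eq_zero {n : ℕ} {f : GaloisField 2 n → GaloisField 2 n}
    (hf : Crooked n f) {x y : GaloisField 2 n} (hx : x ≠ 0) (h : Bf n f x y = 0) :
    y = 0 ∨ y = x := by
  by_contra! hy
  refine hf.2.1 x y 0 hy.2.symm hy.1 hx ?_
  rw [hf.1, add_zero, add_zero, add_comm, ← add_assoc]
  exact h

/-- For nonzero `x`, the additive map `y ↦ B_f(x, y)` has a kernel of order two, so any hyperplane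
containing its image is its image. -/
theorem Crooked.range_bilin_eq_ker {n : ℕ} {f : GaloisField 2 n → GaloisField 2 n}
    (hf : Crooked n f) (hq : IsQuadratic n f) {x : GaloisField 2 n} (hx : x ≠ 0)
    {φ : GaloisField 2 n →ₗ[ZMod 2] ZMod 2} (hφ : φ ≠ 0) (h : ∀ y, φ (Bf n f x y) = 0) :
    LinearMap.range (hq.bilin x) = LinearMap.ker φ := by
  have hle : LinearMap.range (hq.bilin x) ≤ LinearMap.ker φ := by
    rintro _ ⟨y, rfl⟩
    exact h y
  refine Submodule.eq_of_le_of_finrank_le hle ?_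
  have hker : LinearMap.ker (hq.bilin x) ≤ Submodule.span (ZMod 2) {x} := by
    intro y hy
    rcases hf.eq_zero_or_eq_of_Bf_eq_zero hx (LinearMap.mem_ker.1 hy) with rfl | rfl
    · exact Submodule.zero_mem _
    · exact Submodule.mem_span_singleton_self _
  have h1 := Submodule.finrank_mono hker
  rw [finrank_span_singleton hx] at h1
  have h2 := LinearMap.finrank_range_add_finrank_ker (hq.bilin x)
  have h3 := Module.Dual.finrank_ker_add_one_of_ne_zero hφ
  omega

theorem stmt_12 (n : ℕ) (hn : 1 < n) (hodd : Odd n)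
    (f : GaloisField 2 n → GaloisField 2 n)
    (hf : Crooked n f) (hquad : IsQuadratic n f)
    (γ₁ γ₂ : GaloisField 2 n) (hγ₁ : γ₁ ≠ 0) (hγ₂ : γ₂ ≠ 0) :
    ∃ x y z : GaloisField 2 n, x ≠ 0 ∧ y ≠ 0 ∧ z ≠ 0 ∧
      Bf n f x y = γ₁ ∧ Bf n f x z = γ₂ := by
  have hfin : Module.finrank (ZMod 2) (GaloisField 2 n) = n := GaloisField.finrank 2 (by omega)
  obtain ⟨φ, hφ, h₁, h₂⟩ := exists_dual_ne_zero_apply_eq_zero_pair (F := ZMod 2)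
    (by grind) γ₁ γ₂
  have halt : (hquad.bilin.compr₂ φ).IsAlt := fun x => by
    rw [LinearMap.compr₂_apply, hquad.bilin_apply, hf.Bf_self, map_zero]
  obtain ⟨x, hx, hrad⟩ := halt.exists_ne_zero_forall_apply_eq_zero (by rwa [hfin])
  have hrange := hf.range_bilin_eq_ker hquad hx hφ hrad
  have hline : ∀ γ, γ ≠ 0 → φ γ = 0 → ∃ y, y ≠ 0 ∧ Bf n f x y = γ := by
    intro γ hγ hφγ
    obtain ⟨y, rfl⟩ : γ ∈ LinearMap.range (hquad.bilin x) := hrange ▸ hφγ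
    exact ⟨y, fun hy => hγ (by rw [hy, map_zero]), rfl⟩
  obtain ⟨y, hy, hxy⟩ := hline γ₁ hγ₁ h₁
  obtain ⟨z, hz, hxz⟩ := hline γ₂ hγ₂ h₂
  exact ⟨x, y, z, hx, hy, hz, hxy, hxz⟩
end

section
/- Let f be a crooked function over K = F_{2^n}. Then f is a permutation (a bijection) of K. -/
theorem stmt_15 (n : ℕ) (hn : 0 < n)
    (f : GaloisField 2 n → GaloisField 2 n) (hf : Crooked n f) :
    Function.Bijective f := by
  refine Function.Injective.bijective_of_finite fun x y hxy => ?_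
  by_contra hne
  have ha : x + y ≠ 0 := fun h => hne (CharTwo.add_eq_zero.mp h)
  refine hf.2.2 (x + y) ha x x x ?_
  rw [CharTwo.add_cancel_left, ← hxy]
  simp [CharTwo.add_self_eq_zero]
end

section
/- Let f : K → K be a function over K = F_{2^n} with f(0) = 0. Then f is crooked if and only if the sets H_a := {f(x + a) + f(x) : x ∈ K}, for a ∈ K ∖ {0}, are pairwise distinct and each H_a is the complement of an F_2-hyperplane of K, i.e. H_a = K ∖ W_a for some F_2-linear subspace W_a of K of dimension n − 1. -/
lemma card_pair_add {K : Type*} [AddGroup K] [DecidableEq K] {a : K} (ha : a ≠ 0) (x : K) :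
    ({x, x + a} : Finset K).card = 2 :=
  Finset.card_pair (by simpa using ha)

/-- A subset of half the size is the complement of any disjoint subset of half the size. -/
lemma mem_of_two_mul_card_of_disjoint {K : Type*} [Fintype K] [DecidableEq K]
    {A B : Finset K} (hA : 2 * A.card = Fintype.card K)
    (hB : 2 * B.card = Fintype.card K) (hd : Disjoint A B) {x : K} (hx : x ∉ A) : x ∈ B := by
  have hu : A ∪ B = Finset.univ := by
    rw [← Finset.card_eq_iff_eq_univ, Finset.card_union_of_disjoint hd]
    omega
  have := Finset.mem_univ x
  rw [← hu, Finset.mem_union] at this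
  exact this.resolve_left hx

section Derivative

variable {K : Type*} [AddCommGroup K] [Fintype K] [DecidableEq K]

/-- The image of the derivative `x ↦ f (x + a) + f x` of `f` in direction `a`. -/
def derivImage (f : K → K) (a : K) : Finset K :=
  Finset.univ.image fun x => f (x + a) + f x

lemma mem_derivImage {f : K → K} {a b : K} :
    b ∈ derivImage f a ↔ ∃ x, f (x + a) + f x = b := by
  simp [derivImage]

lemma card_eq_sum_card_fiber_derivImage (f : K → K) (a : K) :
    Fintype.card K =
      ∑ b ∈ derivImage f a, (Finset.univ.filter fun x => f (x + a) + f x = b).card :=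
  Finset.card_eq_sum_card_image _ _

lemma pair_subset_fiber (h2 : ∀ x : K, x + x = 0) (f : K → K) (a x : K) :
    ({x, x + a} : Finset K) ⊆
      Finset.univ.filter fun y => f (y + a) + f y = f (x + a) + f x := by
  intro y hy
  simp only [Finset.mem_insert, Finset.mem_singleton] at hy
  rcases hy with rfl | rfl
  · simp
  · simp only [Finset.mem_filter_univ, add_assoc, h2, add_zero]
    exact add_comm _ _

lemma two_mul_card_derivImage (h2 : ∀ x : K, x + x = 0) {f : K → K} {a : K} (ha : a ≠ 0)
    (h : ∀ x y, f (y + a) + f y = f (x + a) + f x → y = x ∨ y = x + a) :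
    2 * (derivImage f a).card = Fintype.card K := by
  rw [card_eq_sum_card_fiber_derivImage f a, mul_comm, ← smul_eq_mul, ← Finset.sum_const]
  refine Finset.sum_congr rfl fun b hb => ?_
  obtain ⟨x, rfl⟩ := mem_derivImage.1 hb
  rw [← card_pair_add ha x]
  congr 1
  refine (pair_subset_fiber h2 f a x).antisymm fun y hy => ?_
  simpa using h x y (by simpa using hy)

lemma eq_or_eq_add_of_two_mul_card_derivImage (h2 : ∀ x : K, x + x = 0) {f : K → K} {a : K}
    (ha : a ≠ 0) (hc : 2 * (derivImage f a).card = Fintype.card K) {x y : K}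
    (h : f (y + a) + f y = f (x + a) + f x) : y = x ∨ y = x + a := by
  have hle : ∀ b ∈ derivImage f a,
      2 ≤ (Finset.univ.filter fun x => f (x + a) + f x = b).card := by
    intro b hb
    obtain ⟨z, rfl⟩ := mem_derivImage.1 hb
    rw [← card_pair_add ha z]
    exact Finset.card_le_card (pair_subset_fiber h2 f a z)
  rw [card_eq_sum_card_fiber_derivImage f a, mul_comm, ← smul_eq_mul, ← Finset.sum_const] at hc
  have hx := (Finset.sum_eq_sum_iff_of_le hle).1 hc _ (mem_derivImage.2 ⟨x, rfl⟩)
  have heq := Finset.eq_of_subset_of_card_le (pair_subset_fiber h2 f a x)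
    (by rw [card_pair_add ha x, ← hx])
  have hy : y ∈ ({x, x + a} : Finset K) := by rw [heq]; simpa using h
  simpa using hy

/-- In a group of exponent two, a set of half the size without three (possibly equal) elements
summing to zero is stable under sums of three elements. -/
lemma add_notMem_iff_of_sum_three_ne_zero (h2 : ∀ x : K, x + x = 0) {A : Finset K}
    (hA : 2 * A.card = Fintype.card K)
    (h3 : ∀ u ∈ A, ∀ v ∈ A, ∀ w ∈ A, u + v + w ≠ 0) {h u : K} (hh : h ∈ A) :
    h + u ∈ A ↔ u ∉ A := by
  constructor
  · intro hu hu'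
    refine h3 h hh u hu' _ hu ?_
    exact h2 (h + u)
  · intro hu
    have hd : Disjoint A (A.image (h + ·)) := by
      rw [Finset.disjoint_left]
      intro v hv hv'
      obtain ⟨w, hw, rfl⟩ := Finset.mem_image.1 hv'
      exact h3 h hh w hw _ hv (h2 (h + w))
    have hc : 2 * (A.image (h + ·)).card = Fintype.card K := by
      rw [Finset.card_image_of_injective _ (add_right_injective h), hA]
    obtain ⟨w, hw, rfl⟩ := Finset.mem_image.1 (mem_of_two_mul_card_of_disjoint hA hc hd hu)
    rwa [← add_assoc, h2, zero_add]

/-- The complement of a set of half the size without three elements summing to zero is a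
subspace over `ZMod 2`. -/
lemma exists_submodule_eq_compl [Module (ZMod 2) K] {A : Finset K}
    (hpos : 0 < Fintype.card K) (hA : 2 * A.card = Fintype.card K)
    (h3 : ∀ u ∈ A, ∀ v ∈ A, ∀ w ∈ A, u + v + w ≠ 0) :
    ∃ W : Submodule (ZMod 2) K, (A : Set K) = (W : Set K)ᶜ := by
  have h2 : ∀ x : K, x + x = 0 := fun x => by
    rw [← two_smul (ZMod 2) x, show (2 : ZMod 2) = 0 from rfl, zero_smul]
  obtain ⟨h, hh⟩ : A.Nonempty := Finset.card_pos.1 (by omega)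
  have key {h u : K} := @add_notMem_iff_of_sum_three_ne_zero K _ _ _ h2 A hA h3 h u
  let S : AddSubgroup K :=
    { carrier := (A : Set K)ᶜ
      zero_mem' := by
        have := (key (u := 0) hh).1 (by simpa using hh)
        simpa using this
      add_mem' := by
        intro u v hu hv
        simp only [Set.mem_compl_iff, Finset.mem_coe] at hu hv ⊢
        rw [← key hh, ← add_assoc]
        exact (key ((key hh).2 hu)).2 hv
      neg_mem' := by
        intro u hu
        rwa [neg_eq_of_add_eq_zero_left (h2 u)] }
  refine ⟨AddSubgroup.toZModSubmodule 2 S, ?_⟩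
  rw [AddSubgroup.coe_toZModSubmodule]
  exact (compl_compl _).symm

end Derivative

theorem stmt_16 (n : ℕ) (hn : 0 < n)
    (f : GaloisField 2 n → GaloisField 2 n) (h0 : f 0 = 0) :
    Crooked n f ↔
      (Set.InjOn (fun a => {b : GaloisField 2 n | ∃ x, f (x + a) + f x = b})
        {a : GaloisField 2 n | a ≠ 0} ∧
       ∀ a : GaloisField 2 n, a ≠ 0 →
         ∃ W : Submodule (ZMod 2) (GaloisField 2 n),
           Module.finrank (ZMod 2) W = n - 1 ∧
           {b : GaloisField 2 n | ∃ x, f (x + a) + f x = b} =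
             (W : Set (GaloisField 2 n))ᶜ) := by
  classical
  have : Fintype (GaloisField 2 n) := Fintype.ofFinite _
  have hcard : Fintype.card (GaloisField 2 n) = 2 * 2 ^ (n - 1) := by
    rw [← Nat.card_eq_fintype_card, GaloisField.card 2 n hn.ne', mul_comm, ← pow_succ,
      Nat.sub_add_cancel hn]
  have h2 : ∀ x : GaloisField 2 n, x + x = 0 := CharTwo.add_self_eq_zero
  have hH : ∀ a, {b : GaloisField 2 n | ∃ x, f (x + a) + f x = b} = derivImage f a := by
    intro a
    ext b
    simp [mem_derivImage]
  have hW : ∀ (W : Submodule (ZMod 2) (GaloisField 2 n)) (A : Finset (GaloisField 2 n)),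
      (A : Set (GaloisField 2 n)) = (W : Set (GaloisField 2 n))ᶜ →
        A.card + Nat.card W = 2 * 2 ^ (n - 1) := by
    intro W A hA
    have h := Set.ncard_add_ncard_compl (W : Set (GaloisField 2 n))
    rw [← hA, Set.ncard_coe_finset, Nat.card_eq_fintype_card, hcard] at h
    rw [← h, add_comm]
    rfl
  have hWcard : ∀ W : Submodule (ZMod 2) (GaloisField 2 n),
      Nat.card W = 2 ^ Module.finrank (ZMod 2) W := by
    intro W
    rw [Module.natCard_eq_pow_finrank (K := ZMod 2), Nat.card_zmod]
  simp only [hH]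
  constructor
  · rintro ⟨-, hapn, hthree⟩
    have hA : ∀ a, a ≠ 0 → 2 * (derivImage f a).card = Fintype.card (GaloisField 2 n) := by
      intro a ha
      refine two_mul_card_derivImage h2 ha fun x y hxy => ?_
      by_contra! hne
      refine hapn x (x + a) y (by simpa using ha) hne.2.symm hne.1.symm ?_
      have : x + (x + a) + y = y + a := by rw [← add_assoc, h2, zero_add, add_comm]
      rw [this, add_comm (f x), add_assoc, add_comm (f y), hxy, h2]
    have h3 : ∀ a, a ≠ 0 → ∀ u ∈ derivImage f a, ∀ v ∈ derivImage f a, ∀ w ∈ derivImage f a,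
        u + v + w ≠ 0 := by
      intro a ha u hu v hv w hw
      obtain ⟨x, rfl⟩ := mem_derivImage.1 hu
      obtain ⟨y, rfl⟩ := mem_derivImage.1 hv
      obtain ⟨z, rfl⟩ := mem_derivImage.1 hw
      convert hthree a ha x y z using 1
      ring
    have hzero : ∀ a, a ≠ 0 → 0 ∉ derivImage f a := fun a ha h =>
      h3 a ha 0 h 0 h 0 h (by simp)
    refine ⟨?_, fun a ha => ?_⟩
    · intro a ha b hb hab
      simp only [Set.mem_ofPred_eq] at ha hb
      have hab : derivImage f a = derivImage f b := Finset.coe_injective hab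
      by_contra hne
      have hne' : a + b ≠ 0 := fun h => hne (CharTwo.add_eq_zero.1 h)
      refine hzero (a + b) hne' (mem_of_two_mul_card_of_disjoint (hA a ha) (hA _ hne') ?_
        (hzero a ha))
      rw [Finset.disjoint_right]
      intro u hu hu'
      obtain ⟨x, rfl⟩ := mem_derivImage.1 hu
      refine h3 a ha _ (mem_derivImage.2 ⟨x, rfl⟩) (f (x + a + b) + f (x + a))
        (hab ▸ mem_derivImage.2 ⟨x + a, rfl⟩) _ hu' ?_
      rw [← add_assoc x a b]
      linear_combination h2 (f x) + h2 (f (x + a)) + h2 (f (x + a + b))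
    · obtain ⟨W, hWA⟩ := exists_submodule_eq_compl (by rw [hcard]; positivity) (hA a ha) (h3 a ha)
      refine ⟨W, ?_, hWA⟩
      have h := hW W _ hWA
      have hAa := hA a ha
      rw [hWcard] at h
      exact Nat.pow_right_injective le_rfl (show 2 ^ _ = 2 ^ (n - 1) by omega)
  · rintro ⟨-, hyp⟩
    refine ⟨h0, fun x y z hxy hyz hxz h => ?_, fun a ha x y z h => ?_⟩
    · have ha : x + y ≠ 0 := fun h => hxy (CharTwo.add_eq_zero.1 h)
      obtain ⟨W, hr, hWA⟩ := hyp (x + y) ha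
      have hc := hW W _ hWA
      rw [hWcard, hr] at hc
      have hx : x + (x + y) = y := by rw [← add_assoc, h2, zero_add]
      have := eq_or_eq_add_of_two_mul_card_derivImage h2 ha (by omega) (x := x) (y := z) (f := f)
        (by
          rw [hx, add_comm z]
          linear_combination h - h2 (f x) - h2 (f y))
      rw [hx] at this
      exact this.elim (fun h => hxz h.symm) fun h => hyz h.symm
    · obtain ⟨W, hr, hWA⟩ := hyp a ha
      have hindex : W.toAddSubgroup.index = 2 := by
        have := W.toAddSubgroup.card_mul_index
        rw [Nat.card_eq_fintype_card (α := GaloisField 2 n), hcard,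
          show Nat.card W.toAddSubgroup = 2 ^ (n - 1) from hr ▸ hWcard W, mul_comm 2] at this
        exact Nat.eq_of_mul_eq_mul_left (by positivity) this
      have hnot : ∀ t, f (t + a) + f t ∉ W.toAddSubgroup := by
        intro t ht
        have : f (t + a) + f t ∈ (W : Set (GaloisField 2 n))ᶜ :=
          hWA ▸ Finset.mem_coe.2 (mem_derivImage.2 ⟨t, rfl⟩)
        exact this ht
      have hadd := (AddSubgroup.add_mem_iff_of_index_two hindex).2
        (iff_of_false (hnot x) (hnot y))
      have hz : f (z + a) + f z = -(f (x + a) + f x + (f (y + a) + f y)) := by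
        linear_combination h
      exact hnot z (hz ▸ neg_mem hadd)
end
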